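/- arXiv:2301.13794 — 6 statements merged into one kernel-verified Lean document; each statement's English description precedes it below -/
import Mathlib

section
/- Let M, B, c be real numbers with M > 0, B ≥ 0, c > 0. Define p = max(B/M, c) and S = max(M − B/c, 0). Then p ≥ c, S ≥ 0, B/p + S = M, and if p > c then S = 0. (Existence part of the equilibrium characterization of the token market: p is the equilibrium token price, S the speculative demand, B the total dollar payments bid, M the token supply, and c = β(1+τ)p^e the discounted expected future token value.) -/
/-- Existence part of the equilibrium characterization of the token market
(Lemma 2): with token supply `M > 0`, total dollar payments `B ≥ 0`, and
discounted expected future token value `c > 0`, the price `p = max (B/M) c`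
and speculative demand `S = max (M - B/c) 0` satisfy `p ≥ c`, `S ≥ 0`,
market clearing `B/p + S = M`, and `p > c → S = 0`. -/
theorem token_market_equilibrium_existence
    (M B c : ℝ) (hM : 0 < M) (hB : 0 ≤ B) (hc : 0 < c)
    (p S : ℝ) (hp : p = max (B / M) c) (hS : S = max (M - B / c) 0) :
    c ≤ p ∧ 0 ≤ S ∧ B / p + S = M ∧ (c < p → S = 0) := by
  subst hp hS
  refine ⟨le_max_right _ _, le_max_right _ _, ?_⟩
  rcases le_or_gt (B / M) c with h | h
  · have hBM : B / c ≤ M := (div_le_comm₀ hM hc).mp h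
    rw [max_eq_right h, max_eq_left (sub_nonneg.mpr hBM)]
    exact ⟨add_sub_cancel _ _, fun hlt => absurd hlt (lt_irrefl c)⟩
  · have hMB : M ≤ B / c := ((lt_div_comm₀ hc hM).mp h).le
    have hB0 : B ≠ 0 := by
      rintro rfl
      rw [zero_div] at h
      exact lt_asymm h hc
    rw [max_eq_left h.le, max_eq_right (sub_nonpos.mpr hMB), add_zero]
    exact ⟨div_div_cancel₀ hB0, fun _ => rfl⟩
end

section
/- Let M, B, c be real numbers with M > 0, B ≥ 0, c > 0. Suppose p and S are real numbers satisfying p ≥ c, S ≥ 0, B/p + S = M, and such that p > c implies S = 0. Then p = max(B/M, c) and S = max(M − B/c, 0). (Uniqueness part of the equilibrium characterization of the token market.) -/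
/-- Uniqueness part of the equilibrium characterization of the token market
(Lemma 2): any price `p` and speculative demand `S` with `p ≥ c`, `S ≥ 0`,
market clearing `B/p + S = M`, and `S = 0` whenever `p > c`, must equal
`p = max (B/M) c` and `S = max (M - B/c) 0`. -/
theorem token_market_equilibrium_uniqueness
    (M B c : ℝ) (hM : 0 < M) (hB : 0 ≤ B) (hc : 0 < c)
    (p S : ℝ) (hpc : c ≤ p) (hS0 : 0 ≤ S)
    (hclear : B / p + S = M) (hspec : c < p → S = 0) :
    p = max (B / M) c ∧ S = max (M - B / c) 0 := by
  rcases hpc.eq_or_lt with rfl | hlt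
  · have hle : B / M ≤ c := by
      rw [div_le_comm₀ hM hc]
      linarith
    have hS : S = M - B / c := by linarith
    exact ⟨(max_eq_right hle).symm, by rw [← hS, max_eq_left hS0]⟩
  · have hp : 0 < p := hc.trans hlt
    obtain rfl := hspec hlt
    rw [add_zero] at hclear
    have hBM : B / M = p := by
      rw [div_eq_iff hp.ne'] at hclear
      rw [div_eq_iff hM.ne', hclear, mul_comm]
    have hle : M ≤ B / c := hclear ▸ div_le_div_of_nonneg_left hB hc hpc
    exact ⟨by rw [hBM, max_eq_left hpc], (max_eq_right (sub_nonpos.2 hle)).symm⟩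
end

section
/- Let T ≥ 1 be a natural number, β a real number with 0 < β < 1, k a real number, p, M : ℕ → ℝ sequences, and Π : ℕ → ℝ → ℝ. Assume Π (T+1) A = 0 for every real A, and that for every t with 1 ≤ t ≤ T and every real A, Π t A = k − p t · (M t − A) + β · Π (t+1) (M (t+1)). Then for every t with 1 ≤ t ≤ T and every real A, Π t A = ((1 − β^(T−t+1))/(1 − β)) · k − p t · (M t − A). (Proposition 1: the present-discounted value of the auctioneer's expected revenues at the beginning of period t, when he holds A of the M t outstanding tokens, equals the dollar-auction revenue stream minus the expected value of tokens not held by the auctioneer.) -/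
/-- Proposition 1: given the one-period recursion
`Pi t A = k - p t * (M t - A) + β * Pi (t+1) (M (t+1))` for `1 ≤ t ≤ T`
and zero continuation value after period `T`, the present-discounted value of
the auctioneer's expected revenues at the beginning of period `t`, holding `A`
of the `M t` outstanding tokens, is
`((1 - β^(T - t + 1))/(1 - β)) * k - p t * (M t - A)`. -/
theorem auctioneer_expected_revenues
    (T : ℕ) (hT : 1 ≤ T) (β : ℝ) (hβ0 : 0 < β) (hβ1 : β < 1) (k : ℝ)
    (p M : ℕ → ℝ) (Pi : ℕ → ℝ → ℝ)
    (hend : ∀ A : ℝ, Pi (T + 1) A = 0)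
    (hrec : ∀ t : ℕ, 1 ≤ t → t ≤ T → ∀ A : ℝ,
      Pi t A = k - p t * (M t - A) + β * Pi (t + 1) (M (t + 1))) :
    ∀ t : ℕ, 1 ≤ t → t ≤ T → ∀ A : ℝ,
      Pi t A = ((1 - β ^ (T - t + 1)) / (1 - β)) * k - p t * (M t - A) := by
  have hβ : 1 - β ≠ 0 := (sub_pos.mpr hβ1).ne'
  intro t ht htT
  induction htT using Nat.decreasingInduction with
  | self =>
    intro A
    rw [hrec T ht le_rfl, hend]
    simp [hβ]
  | of_succ t htT ih =>
    intro A
    rw [hrec t ht htT.le, ih (by omega), show T - t + 1 = (T - (t + 1) + 1) + 1 by omega,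
      pow_succ β (T - (t + 1) + 1)]
    field_simp
    ring
end

section
/- Let T ≥ 1 be a natural number, β a real number with 0 < β < 1, k a real number, and p, M, B : ℕ → ℝ sequences with p t > 0 for all 1 ≤ t ≤ T. Assume: (i) M (t+1) = M t − B t / p t for all 1 ≤ t ≤ T (tokens received as payment are burned); (ii) p t = β · p (t+1) for all 1 ≤ t ≤ T−1 (no-arbitrage pricing with positive speculative demand); (iii) M (T+1) = 0 (all tokens are eventually used); and (iv) B t = k for all 2 ≤ t ≤ T. Then p 1 · M 1 = B 1 + β · ((1 − β^(T−1))/(1 − β)) · k. (Proposition 2: when the auctioneer burns all tokens received as payment, he earns all revenues in period 1, equal to realized period-1 payments plus the present-discounted value of all future expected payments.) -/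
/-- Proposition 2: when the auctioneer burns all tokens received as payment
(`M (t+1) = M t - B t / p t`), the no-arbitrage condition `p t = β * p (t+1)`
holds, the token stock is exhausted after period `T`, and expected payments
equal `k` in every period from 2 onward, then the period-1 revenue from
selling the whole stock equals
`p 1 * M 1 = B 1 + β * ((1 - β^(T-1))/(1 - β)) * k`. -/
theorem revenues_when_burning
    (T : ℕ) (hT : 1 ≤ T) (β : ℝ) (hβ0 : 0 < β) (hβ1 : β < 1) (k : ℝ)
    (p M B : ℕ → ℝ) (hp : ∀ t : ℕ, 1 ≤ t → t ≤ T → 0 < p t)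
    (hburn : ∀ t : ℕ, 1 ≤ t → t ≤ T → M (t + 1) = M t - B t / p t)
    (hnoarb : ∀ t : ℕ, 1 ≤ t → t ≤ T - 1 → p t = β * p (t + 1))
    (hexhaust : M (T + 1) = 0)
    (hpay : ∀ t : ℕ, 2 ≤ t → t ≤ T → B t = k) :
    p 1 * M 1 = B 1 + β * ((1 - β ^ (T - 1)) / (1 - β)) * k := by
  have hβ : 1 - β ≠ 0 := by linarith
  have hpM : ∀ t : ℕ, 1 ≤ t → t ≤ T → p t * M t = B t + p t * M (t + 1) := by
    intro t h1 h2
    have hne := (hp t h1 h2).ne'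
    rw [hburn t h1 h2]
    field_simp
    ring
  have key : ∀ n : ℕ, n + 1 ≤ T →
      p 1 * M 1 = B 1 + β * ((1 - β ^ n) / (1 - β)) * k + β ^ n * (p (n + 1) * M (n + 2)) := by
    intro n
    induction n with
    | zero =>
      intro h
      simpa using hpM 1 le_rfl h
    | succ n ih =>
      intro h
      have hstep := hpM (n + 2) (by omega) h
      rw [hpay (n + 2) (by omega) h] at hstep
      rw [ih (by omega), hnoarb (n + 1) (by omega) (by omega), mul_assoc β (p _), hstep]
      field_simp
      ring
  obtain ⟨n, rfl⟩ : ∃ n, T = n + 1 := ⟨T - 1, by omega⟩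
  rw [key n le_rfl, hexhaust]
  simp
end

section
/- Let k ≥ 0 and β be reals with 0 ≤ β < 1, and define W(α) = (1 − α)(k + α) + β·(α(k + α) − α²/2) for α ∈ ℝ. Then: (a) W is strictly concave on ℝ; (b) the derivative of W at α = 1 equals −(1 − β)(1 + k), which is strictly negative; and (c) W has a unique global maximizer α* = (1 − k(1 − β))/(2 − β), and α* < 1. (The auctioneer's optimal monetary policy induces an auctioneer token share strictly below 1, i.e., strictly positive speculative demand.) -/
/-- The auctioneer's period-1 objective over his period-2 token share,
`W α = (1 - α)(k + α) + β (α (k + α) - α²/2)` with `k ≥ 0` and `0 ≤ β < 1`,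
is (a) strictly concave on ℝ, (b) has derivative `-(1 - β)(1 + k) < 0` at
`α = 1`, and (c) has unique global maximizer `α* = (1 - k(1 - β))/(2 - β) < 1`:
the optimal monetary policy induces strictly positive speculative demand. -/
theorem optimal_token_share
    (k β : ℝ) (hk : 0 ≤ k) (hβ0 : 0 ≤ β) (hβ1 : β < 1)
    (W : ℝ → ℝ)
    (hW : ∀ α : ℝ, W α = (1 - α) * (k + α) + β * (α * (k + α) - α ^ 2 / 2)) :
    StrictConcaveOn ℝ Set.univ W ∧
      (deriv W 1 = -((1 - β) * (1 + k)) ∧ deriv W 1 < 0) ∧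
      ((1 - k * (1 - β)) / (2 - β) < 1 ∧
        ∀ x : ℝ, x ≠ (1 - k * (1 - β)) / (2 - β) →
          W x < W ((1 - k * (1 - β)) / (2 - β))) := by
  have hp : 0 < (1 - β) * (1 + k) := mul_pos (by linarith) (by linarith)
  have hd : 0 < 2 - β := by linarith
  have hderiv : deriv W 1 = -((1 - β) * (1 + k)) := by
    have hid := hasDerivAt_id' (1 : ℝ)
    have h := ((hid.const_sub 1).mul (hid.const_add k)).add
      (((hid.mul (hid.const_add k)).sub ((hid.pow 2).div_const 2)).const_mul β)
    have hWd : HasDerivAt W (-((1 - β) * (1 + k))) 1 := by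
      rw [funext hW]
      exact h.congr_deriv (by norm_num; ring)
    exact hWd.deriv
  refine ⟨⟨convex_univ, ?_⟩, ⟨hderiv, by linarith⟩, ?_, ?_⟩
  · intro x _ y _ hxy a b ha hb hab
    obtain rfl : b = 1 - a := by linarith
    have hgap : 0 < (2 - β) / 2 * (a * (1 - a)) * (x - y) ^ 2 :=
      mul_pos (mul_pos (by linarith) (mul_pos ha hb)) (sq_pos_iff.mpr (sub_ne_zero.mpr hxy))
    simp only [hW, smul_eq_mul]
    linarith
  · rw [div_lt_one hd]
    linarith
  · intro x hx
    set c := (1 - k * (1 - β)) / (2 - β)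
    have hcd : c * (2 - β) = 1 - k * (1 - β) := div_mul_cancel₀ _ hd.ne'
    have hgap : 0 < (2 - β) / 2 * (x - c) ^ 2 :=
      mul_pos (by linarith) (sq_pos_iff.mpr (sub_ne_zero.mpr hx))
    have hsq : W c - W x = (2 - β) / 2 * (x - c) ^ 2 := by
      rw [hW, hW]
      linear_combination (x - c) * hcd
    linarith
end

section
/- Let k > 0, B > 0, σ > −1, τ > −1 be reals and let S be a real with 0 ≤ S < 1. Define A₂ = (1 − S)(1 + σ)(1 + τ), M₂ = A₂ + S(1 + τ), α = A₂/M₂, and p = (k + α)/M₂. If S > 0 and S = 1 − B/((1 + τ)·p), then α² + k·α = B(1 + σ). (Fixed-point step in the proof of Lemma 3: consistency of an interior speculative demand with equilibrium pricing forces the quadratic equation determining the auctioneer's token share.) -/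
/-- Fixed-point step in the proof of Lemma 3: with initial token stock
normalized to 1, period-1 speculative demand `0 ≤ S < 1`, auctioneer's
period-2 holding `A₂ = (1-S)(1+σ)(1+τ)`, stock `M₂ = A₂ + S(1+τ)`, share
`α = A₂/M₂`, and expected price `p = (k + α)/M₂`, if the speculative demand is
interior (`S > 0`) and consistent with equilibrium pricing
(`S = 1 - B/((1+τ)p)`), then `α² + k α = B(1+σ)`. -/
theorem fixed_point_quadratic
    (k B σ τ S : ℝ) (hk : 0 < k) (hB : 0 < B) (hσ : -1 < σ) (hτ : -1 < τ)
    (hS0 : 0 ≤ S) (hS1 : S < 1)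
    (A₂ M₂ α p : ℝ)
    (hA : A₂ = (1 - S) * (1 + σ) * (1 + τ))
    (hM : M₂ = A₂ + S * (1 + τ))
    (hα : α = A₂ / M₂) (hp : p = (k + α) / M₂)
    (hSpos : 0 < S) (hfix : S = 1 - B / ((1 + τ) * p)) :
    α ^ 2 + k * α = B * (1 + σ) := by
  have hσ' : 0 < 1 + σ := by linarith
  have hτ' : 0 < 1 + τ := by linarith
  have hS' : 0 < 1 - S := by linarith
  have hA0 : 0 < A₂ := by rw [hA]; positivity
  have hM0 : 0 < M₂ := by rw [hM]; positivity
  have hα0 : 0 < α := by rw [hα]; positivity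
  have hp0 : 0 < p := by rw [hp]; positivity
  have hpay : (1 - S) * ((1 + τ) * p) = B := by
    rw [← eq_div_iff (by positivity)]
    linarith
  calc α ^ 2 + k * α = α * (k + α) := by ring
    _ = A₂ * p := by rw [hp]; nth_rewrite 1 [hα]; ring
    _ = B * (1 + σ) := by rw [hA, ← hpay]; ring
end
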